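/- Let V be a finite-dimensional ℤ/2-graded vector space over a field k of characteristic zero with a differential d and a nondegenerate bilinear form B of degree δ ∈ {0,1} that is supersymmetric and compatible with d. Then there exist an odd linear operator s : V → V and an even linear operator t : V → V such that: s² = 0; t² = t; s∘t = t∘s = 0; d∘t = t∘d = 0; d∘s + s∘d = id_V − t; B(t x, y) = B(x, t y) for all x, y; B(s x, y) = (−1)^{|x|} B(x, s y) for all homogeneous x and all y; and im t ⊆ ker d with the quotient map ker d → H(V) = ker d / im d restricting to a linear isomorphism from im t onto H(V). -/

import Mathlib

/-- `x` is homogeneous of parity `p` with respect to the grading `V = V0 ⊕ V1`. -/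
def Homog {k V : Type*} [Field k] [AddCommGroup V] [Module k V]
    (V0 V1 : Submodule k V) (p : ZMod 2) (x : V) : Prop :=
  if p = 0 then x ∈ V0 else x ∈ V1

/-- The homology `H(V) = ker d / im d` of `(V, d)`. -/
abbrev HomologyOf {k V : Type*} [Field k] [AddCommGroup V] [Module k V]
    (d : V →ₗ[k] V) :=
  LinearMap.ker d ⧸ (LinearMap.range d).comap (LinearMap.ker d).subtype

/-- The quotient map `ker d → H(V)`. -/
def homClass {k V : Type*} [Field k] [AddCommGroup V] [Module k V]
    (d : V →ₗ[k] V) : LinearMap.ker d →ₗ[k] HomologyOf d :=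
  ((LinearMap.range d).comap (LinearMap.ker d).subtype).mkQ

theorem zmod_two_eq_zero_or_one (p : ZMod 2) : p = 0 ∨ p = 1 := by
  revert p; decide

theorem neg_one_pow_val_add {R : Type*} [Ring R] (p q : ZMod 2) :
    (-1 : R) ^ (p + q).val = (-1) ^ p.val * (-1) ^ q.val := by
  rcases zmod_two_eq_zero_or_one p with rfl | rfl <;>
  rcases zmod_two_eq_zero_or_one q with rfl | rfl <;>
  simp [CharTwo.add_self_eq_zero, ZMod.val_one]

section Parity

variable {k V : Type*} [Field k] [AddCommGroup V] [Module k V]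

/-- Every operator on a vector space has a generalized inverse. -/
theorem exists_generalized_inverse (d : Module.End k V) :
    ∃ g : Module.End k V, d * g * d = d := by
  obtain ⟨g, hg⟩ := d.rangeRestrict.exists_rightInverse_of_surjective d.range_rangeRestrict
  obtain ⟨g', hg'⟩ := LinearMap.exists_extend g
  refine ⟨g', LinearMap.ext fun x => ?_⟩
  have h1 : g' (d x) = g (d.rangeRestrict x) := by
    rw [← hg']; rfl
  have h2 := congrArg Subtype.val (LinearMap.congr_fun hg (d.rangeRestrict x))
  simpa [h1] using h2

/-- An odd operator has an odd generalized inverse; `ε` is the parity operator. -/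
theorem exists_odd_generalized_inverse [CharZero k] {ε d : Module.End k V}
    (hε : ε * ε = 1) (hεd : ε * d = -(d * ε)) :
    ∃ g : Module.End k V, ε * g = -(g * ε) ∧ d * g * d = d := by
  obtain ⟨g, hg⟩ := exists_generalized_inverse d
  have hdε : d * ε = -(ε * d) := by rw [hεd, neg_neg]
  have hconj : d * (ε * g * ε) * d = -d := by
    calc d * (ε * g * ε) * d = (d * ε) * g * (ε * d) := by noncomm_ring
      _ = -(ε * d) * g * -(d * ε) := by rw [← hdε, ← hεd]
      _ = ε * (d * g * d) * ε := by noncomm_ring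
      _ = -d := by rw [hg, hεd, neg_mul, mul_assoc, hε, mul_one]
  refine ⟨(1 / 2 : k) • (g - ε * g * ε), ?_, ?_⟩
  · have h1 : ε * (ε * g * ε) = g * ε := by rw [← mul_assoc, ← mul_assoc, hε, one_mul]
    have h2 : ε * g * ε * ε = ε * g := by rw [mul_assoc, hε, mul_one]
    rw [mul_smul_comm, smul_mul_assoc, mul_sub, sub_mul, h1, h2, ← smul_neg, neg_sub]
  · rw [mul_smul_comm, smul_mul_assoc, mul_sub, sub_mul, hg, hconj, sub_neg_eq_add, ← two_smul k d,
      smul_smul]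
    norm_num

/-- A self-adjoint odd generalized inverse of the differential `d` can be replaced by one which
moreover satisfies `u² = 0` and `u d u = u`. -/
theorem exists_special_homotopy [CharZero k] {ε d s : Module.End k V} {B : V →ₗ[k] V →ₗ[k] k}
    (hε : ε * ε = 1) (hεd : ε * d = -(d * ε)) (hεs : ε * s = -(s * ε))
    (hdd : d * d = 0) (hdsd : d * s * d = d)
    (hBd : ∀ x y, B (d x) y = -B (ε x) (d y)) (hBs : ∀ x y, B (s x) y = B (ε x) (s y)) :
    ∃ u : Module.End k V, ε * u = -(u * ε) ∧ d * u * d = d ∧ u * d * u = u ∧ u * u = 0 ∧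
      ∀ x y, B (u x) y = B (ε x) (u y) := by
  have ee (x) : ε (ε x) = x := LinearMap.congr_fun hε x
  have ed (x) : ε (d x) = -d (ε x) := LinearMap.congr_fun hεd x
  have es (x) : ε (s x) = -s (ε x) := LinearMap.congr_fun hεs x
  have dd (x) : d (d x) = 0 := LinearMap.congr_fun hdd x
  have dsd (x) : d (s (d x)) = d x := LinearMap.congr_fun hdsd x
  obtain ⟨v, hv⟩ : ∃ v : Module.End k V, v = s - (1 / 2 : k) • (d * s * s + s * s * d) := ⟨_, rfl⟩
  have v_apply (x) : v x = s x - (1 / 2 : k) • (d (s (s x)) + s (s (d x))) := by simp [hv]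
  have ev (x) : ε (v x) = -v (ε x) := by
    simp only [v_apply, map_sub, map_smul, map_add, es, ed, map_neg, neg_neg]
    module
  have dv (x) : d (v x) = d (s x) - (1 / 2 : k) • d (s (s (d x))) := by
    simp [v_apply, dd]
  have vd (x) : v (d x) = s (d x) - (1 / 2 : k) • d (s (s (d x))) := by
    simp [v_apply, dd]
  have dvd (x) : d (v (d x)) = d x := by simp [vd, dd, dsd]
  have dvvd (x) : d (v (v (d x))) = 0 := by
    simp only [dv, vd, map_sub, map_smul, dsd, dd]
    module
  have Bv (x y) : B (v x) y = B (ε x) (v y) := by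
    simp only [v_apply, map_sub, map_smul, map_add, LinearMap.sub_apply, LinearMap.smul_apply,
      LinearMap.add_apply, hBs, hBd, es, ed, ee, map_neg, LinearMap.neg_apply, neg_neg]
    ring
  refine ⟨v * d * v, ?_, ?_, ?_, ?_, fun x y => ?_⟩
  · ext x; simp [ev, ed]
  · ext x; simp [dvd]
  · ext x; simp [dvd]
  · ext x; simp [dvvd]
  · simp [Bv, hBd, ev, ed, ee]

/-- The left adjoint of an operator with respect to a left-nondegenerate form, twisted by `ε`. -/
theorem exists_twisted_adjoint [FiniteDimensional k V] {B : V →ₗ[k] V →ₗ[k] k}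
    (hB : ∀ v, (∀ u, B v u = 0) → v = 0) (ε g : Module.End k V) :
    ∃ a : Module.End k V, ∀ x y, B (a x) y = B (ε x) (g y) := by
  have hinj : Function.Injective B := by
    rw [injective_iff_map_eq_zero]
    exact fun v hv => hB v fun u => by rw [hv, LinearMap.zero_apply]
  let E := LinearMap.linearEquivOfInjective (V₂ := Module.Dual k V) B hinj
    Subspace.dual_finrank_eq.symm
  refine ⟨E.symm.toLinearMap ∘ₗ g.dualMap ∘ₗ B ∘ₗ ε, fun x y => ?_⟩
  have h : B (E.symm (g.dualMap (B (ε x)))) = g.dualMap (B (ε x)) := E.apply_symm_apply _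
  exact LinearMap.congr_fun h y

/-- An odd generalized inverse may be chosen self-adjoint. The hypotheses `hη` and `hεB` hold for
a supersymmetric form of degree `0` with `η = ε`, `c = 1`, and of degree `1` with
`η = 1`, `c = -1`. -/
theorem exists_selfAdjoint_generalized_inverse [CharZero k] [FiniteDimensional k V]
    {ε η d : Module.End k V} {B : V →ₗ[k] V →ₗ[k] k} {c : k}
    (hε : ε * ε = 1) (hεd : ε * d = -(d * ε))
    (hB : ∀ v, (∀ u, B v u = 0) → v = 0)
    (hBd : ∀ x y, B (d x) y = -B (ε x) (d y))
    (hεB : ∀ x y, B (ε x) y = c * B x (ε y))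
    (hη : ∀ x y, B x y = B (η y) x)
    (hcη : (c = 1 ∧ η = ε) ∨ (c = -1 ∧ η = 1)) :
    ∃ s : Module.End k V, ε * s = -(s * ε) ∧ d * s * d = d ∧
      ∀ x y, B (s x) y = B (ε x) (s y) := by
  obtain ⟨g, hεg, hg⟩ := exists_odd_generalized_inverse hε hεd
  obtain ⟨a, ha⟩ := exists_twisted_adjoint hB ε g
  have hext {x y : V} (h : ∀ u, B x u = B y u) : x = y :=
    sub_eq_zero.mp (hB _ fun u => by simp [h u])
  have ee (x) : ε (ε x) = x := LinearMap.congr_fun hε x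
  have ed (x) : ε (d x) = -d (ε x) := LinearMap.congr_fun hεd x
  have eg (x) : ε (g x) = -g (ε x) := LinearMap.congr_fun hεg x
  have gd (x) : d (g (d x)) = d x := LinearMap.congr_fun hg x
  have ea (x) : ε (a x) = -a (ε x) := hext fun u => by
    rw [hεB, ha, map_neg, LinearMap.neg_apply, ha, hεB (ε x), eg]
    simp
  have ad (x) : d (a (d x)) = d x := hext fun u => by
    simp only [hBd, ha, ea, ed, gd, ee, map_neg, LinearMap.neg_apply, neg_neg]
  have hga (x y) : B (g x) y = B (ε x) (a y) := by
    rcases hcη with ⟨rfl, rfl⟩ | ⟨rfl, rfl⟩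
    · rw [hη (g x), ← ha, hη]
    · have h1 := ha (ε y) x
      have h2 := hεB (a y) x
      rw [ee] at h1
      rw [ea, map_neg, LinearMap.neg_apply, neg_one_mul, neg_inj, h1] at h2
      rw [hη (g x), Module.End.one_apply, h2, hη, Module.End.one_apply]
  refine ⟨(1 / 2 : k) • (g + a), ?_, ?_, fun x y => ?_⟩
  · ext x; simp [eg, ea]; module
  · ext x; simp [gd, ad]; module
  · simp [ha, hga, add_comm]

/-- A grading `V = V0 ⊕ V1` is encoded by an involution acting by `(-1)^p` in parity `p`. -/
theorem exists_parity_operator [CharZero k] {V0 V1 : Submodule k V} (h : IsCompl V0 V1) :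
    ∃ ε : Module.End k V, ε * ε = 1 ∧
      ∀ (p : ZMod 2) (x : V), Homog V0 V1 p x ↔ ε x = (-1 : k) ^ p.val • x := by
  obtain ⟨ε, hε⟩ : ∃ ε : Module.End k V, ∀ x, ε x = (2 : k) • V0.projection V1 h x - x :=
    ⟨(2 : k) • V0.projection V1 h - 1, fun x => by simp⟩
  have hidem (x : V) : V0.projection V1 h (V0.projection V1 h x) = V0.projection V1 h x := by simp
  refine ⟨ε, ?_, fun p x => ?_⟩
  · ext x
    simp only [Module.End.mul_apply, Module.End.one_apply, hε, map_sub, map_smul, hidem]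
    module
  · have h2 : (2 : k) ≠ 0 := two_ne_zero
    rcases zmod_two_eq_zero_or_one p with rfl | rfl
    · have : ε x = x ↔ V0.projection V1 h x = x := by
        rw [hε, sub_eq_iff_eq_add, ← two_smul k x, smul_right_inj h2]
      simp [Homog, this]
    · have : ε x = -x ↔ V0.projection V1 h x = 0 := by
        rw [hε, sub_eq_iff_eq_add, neg_add_cancel, smul_eq_zero_iff_right h2]
      simp [Homog, this, ZMod.val_one]

/-- Two linear maps agreeing on homogeneous elements are equal. -/
theorem linearMap_ext_homog {W : Type*} [AddCommGroup W] [Module k W] {V0 V1 : Submodule k V}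
    (h : IsCompl V0 V1) {f g : V →ₗ[k] W}
    (hfg : ∀ (p : ZMod 2) (x : V), Homog V0 V1 p x → f x = g x) : f = g := by
  ext x
  obtain ⟨y, hy, z, hz, rfl⟩ := Submodule.mem_sup.mp (h.sup_eq_top ▸ Submodule.mem_top (x := x))
  rw [map_add, map_add, hfg 0 y (by simpa [Homog] using hy), hfg 1 z (by simpa [Homog] using hz)]

/-- An operator is odd if and only if it anticommutes with the parity operator. -/
theorem odd_iff_anticommute {V0 V1 : Submodule k V} (h : IsCompl V0 V1) {ε f : Module.End k V}
    (hε : ∀ (p : ZMod 2) (x : V), Homog V0 V1 p x ↔ ε x = (-1 : k) ^ p.val • x) :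
    (∀ (p : ZMod 2) (x : V), Homog V0 V1 p x → Homog V0 V1 (p + 1) (f x)) ↔
      ε * f = -(f * ε) := by
  have hsign (p : ZMod 2) : (-1 : k) ^ (p + 1).val = -(-1) ^ p.val := by
    simp [neg_one_pow_val_add, ZMod.val_one]
  refine ⟨fun hf => linearMap_ext_homog h fun p x hx => ?_, fun hf p x hx => ?_⟩
  · have h1 := (hε _ _).mp (hf p x hx)
    have h2 := (hε _ _).mp hx
    simp [h1, h2, hsign]
  · have h1 : ε (f x) = -f (ε x) := LinearMap.congr_fun hf x
    rw [hε, h1, (hε _ _).mp hx, map_smul, hsign, neg_smul]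

/-- A form of degree `δ` satisfies `B (ε x) y = (-1)^δ B x (ε y)`, and supersymmetry reads
`B x y = B (ε y) x` in degree `0` and `B x y = B y x` in degree `1`. -/
theorem exists_symmetry_twist {V0 V1 : Submodule k V} (h : IsCompl V0 V1) {ε : Module.End k V}
    (hε : ∀ (p : ZMod 2) (x : V), Homog V0 V1 p x ↔ ε x = (-1 : k) ^ p.val • x)
    {δ : ZMod 2} {B : V →ₗ[k] V →ₗ[k] k}
    (hdeg : ∀ (p q : ZMod 2) (x y : V), Homog V0 V1 p x → Homog V0 V1 q y →
      p + q ≠ δ → B x y = 0)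
    (hsym : ∀ (p q : ZMod 2) (x y : V), Homog V0 V1 p x → Homog V0 V1 q y →
      B x y = (-1 : k) ^ (p.val * q.val) * B y x) :
    ∃ (c : k) (η : Module.End k V),
      (∀ x y, B (ε x) y = c * B x (ε y)) ∧ (∀ x y, B x y = B (η y) x) ∧
      ((c = 1 ∧ η = ε) ∨ (c = -1 ∧ η = 1)) := by
  have hext {f g : V →ₗ[k] V →ₗ[k] k} (H : ∀ (p q : ZMod 2) (x y : V), Homog V0 V1 p x →
      Homog V0 V1 q y → f x y = g x y) : f = g :=
    linearMap_ext_homog h fun p x hx => linearMap_ext_homog h fun q y hy => H p q x y hx hy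
  have hεB : B ∘ₗ ε = (-1 : k) ^ δ.val • B.compl₂ ε := hext fun p q x y hx hy => by
    simp only [LinearMap.comp_apply, LinearMap.smul_apply, LinearMap.compl₂_apply,
      (hε p x).mp hx, (hε q y).mp hy, map_smul, smul_eq_mul]
    by_cases hpq : p + q = δ
    · rw [← hpq, ← mul_assoc, neg_one_pow_val_add]
      rcases neg_one_pow_eq_or k q.val with h | h <;> simp [h]
    · rw [hdeg p q x y hx hy hpq, mul_zero, mul_zero, mul_zero]
  refine ⟨(-1 : k) ^ δ.val, if δ = 0 then ε else 1,
    fun x y => LinearMap.congr_fun₂ hεB x y, ?_, ?_⟩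
  · suffices B = (B ∘ₗ (if δ = 0 then ε else 1)).flip from LinearMap.congr_fun₂ this
    refine hext fun p q x y hx hy => ?_
    simp only [LinearMap.flip_apply, LinearMap.comp_apply]
    by_cases hpq : p + q = δ
    · rw [hsym p q x y hx hy, ← hpq]
      rcases zmod_two_eq_zero_or_one p with rfl | rfl <;>
      rcases zmod_two_eq_zero_or_one q with rfl | rfl <;>
      simp [(hε _ y).mp hy, ZMod.val_one, CharTwo.add_self_eq_zero]
    · rw [hdeg p q x y hx hy hpq]
      split_ifs
      · simp [(hε q y).mp hy, hdeg q p y x hy hx (add_comm p q ▸ hpq)]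
      · exact (hdeg q p y x hy hx (add_comm p q ▸ hpq)).symm
  · rcases zmod_two_eq_zero_or_one δ with rfl | rfl <;> simp [ZMod.val_one]

end Parity

/-- every finite-dimensional dg vector space with a nondegenerate
supersymmetric degree-`δ` form compatible with `d` admits operators `s` (odd) and `t`
(even) with `s² = 0`, `t² = t`, `st = ts = 0`, `dt = td = 0`, `ds + sd = id − t`,
compatible with `B`, such that `im t ⊆ ker d` maps isomorphically onto the homology. -/
theorem statement6 {k V : Type*} [Field k] [CharZero k] [AddCommGroup V] [Module k V]
    [FiniteDimensional k V]
    (V0 V1 : Submodule k V) (hgrad : IsCompl V0 V1)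
    (δ : ZMod 2)
    (d : V →ₗ[k] V)
    (hd_odd : ∀ (p : ZMod 2) (x : V), Homog V0 V1 p x → Homog V0 V1 (p + 1) (d x))
    (hd2 : ∀ x, d (d x) = 0)
    (B : V →ₗ[k] V →ₗ[k] k)
    (hBdeg : ∀ (p q : ZMod 2) (x y : V), Homog V0 V1 p x → Homog V0 V1 q y →
      p + q ≠ δ → B x y = 0)
    (hBsym : ∀ (p q : ZMod 2) (x y : V), Homog V0 V1 p x → Homog V0 V1 q y →
      B x y = (-1 : k) ^ (p.val * q.val) * B y x)
    (hBd : ∀ (p : ZMod 2) (x : V), Homog V0 V1 p x → ∀ y : V,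
      B (d x) y + (-1 : k) ^ p.val * B x (d y) = 0)
    (hBnondeg : ∀ v : V, (∀ u : V, B v u = 0) → v = 0) :
    ∃ s t : V →ₗ[k] V,
      -- s is odd, t is even
      (∀ (p : ZMod 2) (x : V), Homog V0 V1 p x → Homog V0 V1 (p + 1) (s x)) ∧
      (∀ (p : ZMod 2) (x : V), Homog V0 V1 p x → Homog V0 V1 p (t x)) ∧
      (∀ x, s (s x) = 0) ∧
      (∀ x, t (t x) = t x) ∧
      (∀ x, s (t x) = 0) ∧
      (∀ x, t (s x) = 0) ∧
      (∀ x, d (t x) = 0) ∧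
      (∀ x, t (d x) = 0) ∧
      (∀ x, d (s x) + s (d x) = x - t x) ∧
      (∀ x y : V, B (t x) y = B x (t y)) ∧
      (∀ (p : ZMod 2) (x : V), Homog V0 V1 p x → ∀ y : V,
        B (s x) y = (-1 : k) ^ p.val * B x (s y)) ∧
      -- im t ⊆ ker d, mapping isomorphically onto the homology H(V) = ker d / im d
      LinearMap.range t ≤ LinearMap.ker d ∧
      (∀ (x : V) (hx : x ∈ LinearMap.ker d),
        x ∈ LinearMap.range t → homClass d ⟨x, hx⟩ = 0 → x = 0) ∧
      (∀ h : HomologyOf d,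
        ∃ (x : V) (hx : x ∈ LinearMap.ker d),
          x ∈ LinearMap.range t ∧ homClass d ⟨x, hx⟩ = h) := by
  obtain ⟨ε, hε, hhom⟩ := exists_parity_operator hgrad
  have hεd : ε * d = -(d * ε) := (odd_iff_anticommute hgrad hhom).mp hd_odd
  have hdd : (d : Module.End k V) * d = 0 := LinearMap.ext hd2
  have hBd' : ∀ x y, B (d x) y = -B (ε x) (d y) := by
    have : B ∘ₗ d = -(B.compl₂ d ∘ₗ ε) :=
      linearMap_ext_homog hgrad fun p x hx => LinearMap.ext fun y => by
        have h := hBd p x hx y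
        simp [(hhom p x).mp hx, eq_neg_of_add_eq_zero_left h]
    intro x y
    simpa using LinearMap.congr_fun₂ this x y
  obtain ⟨c, η, hεB, hη, hcη⟩ := exists_symmetry_twist hgrad hhom hBdeg hBsym
  obtain ⟨r, hεr, hdrd, hBr⟩ :=
    exists_selfAdjoint_generalized_inverse hε hεd hBnondeg hBd' hεB hη hcη
  obtain ⟨s, hεs, hdsd, hsds, hss, hBs⟩ := exists_special_homotopy hε hεd hεr hdd hdrd hBd' hBr
  have ee (x) : ε (ε x) = x := LinearMap.congr_fun hε x
  have ed (x) : ε (d x) = -d (ε x) := LinearMap.congr_fun hεd x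
  have es (x) : ε (s x) = -s (ε x) := LinearMap.congr_fun hεs x
  have dsd (x) : d (s (d x)) = d x := LinearMap.congr_fun hdsd x
  have sds (x) : s (d (s x)) = s x := LinearMap.congr_fun hsds x
  have ss (x) : s (s x) = 0 := LinearMap.congr_fun hss x
  obtain ⟨t, ht⟩ : ∃ t : V →ₗ[k] V, ∀ x, t x = x - d (s x) - s (d x) :=
    ⟨LinearMap.id - d ∘ₗ s - s ∘ₗ d, fun x => rfl⟩
  have hdt (x) : d (t x) = 0 := by simp [ht, hd2, dsd]
  have htd (x) : t (d x) = 0 := by simp [ht, hd2, dsd]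
  have hst (x) : s (t x) = 0 := by simp [ht, ss, sds]
  have hts (x) : t (s x) = 0 := by simp [ht, ss, sds]
  have htt (x) : t (t x) = t x := by rw [ht (t x), hst, hdt, map_zero, map_zero, sub_zero, sub_zero]
  refine ⟨s, t, (odd_iff_anticommute hgrad hhom).mpr hεs, fun p x hx => ?_, ss, htt, hst, hts,
    hdt, htd, fun x => ?_, fun x y => ?_, fun p x hx y => ?_, ?_, ?_, ?_⟩
  · rw [hhom] at hx ⊢
    simp [ht, ed, es, hx, smul_sub]
  · rw [ht]; abel
  · simp only [ht, map_sub, LinearMap.sub_apply, hBd', hBs, es, ed, ee, map_neg,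
      LinearMap.neg_apply, neg_neg]
    ring
  · rw [hBs, (hhom p x).mp hx, map_smul, LinearMap.smul_apply, smul_eq_mul]
  · rintro _ ⟨x, rfl⟩
    exact hdt x
  · rintro x hx ⟨y, rfl⟩ h0
    have hmem := (Submodule.Quotient.mk_eq_zero
      ((LinearMap.range d).comap (LinearMap.ker d).subtype)).mp h0
    obtain ⟨z, hz⟩ : t y ∈ LinearMap.range d := hmem
    rw [← htt, ← hz, htd]
  · intro h
    obtain ⟨⟨x, hx⟩, rfl⟩ := Submodule.mkQ_surjective _ h
    have hdx : d x = 0 := hx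
    refine ⟨t x, hdt x, ⟨x, rfl⟩, (Submodule.Quotient.eq _).mpr ⟨-s x, ?_⟩⟩
    simp [ht, hdx]
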